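/- arXiv:2403.16519 — 2 statements merged into one kernel-verified Lean document; each statement's English description precedes it below -/
import Mathlib

section
/- Let k be a field of characteristic 0 with algebraic closure L, and let I ⊆ k[x_1,…,x_n] be a zero-dimensional ideal. For every h ∈ k[x_1,…,x_n], the trace of the multiplication map m_h on k[x_1,…,x_n]/I, viewed as an element of L, equals ∑_{p ∈ V_L(I)} μ(p)·h(p), where μ(p) is the multiplicity of p. -/
set_option synthInstance.maxHeartbeats 1000000
set_option maxHeartbeats 1000000

/-- The multiplicity `μ(p)` of a point `p ∈ V_L(I)`: the dimension over `L` of the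
localization of `L[X]/(I·L[X])` at the maximal ideal corresponding to `p`. -/
noncomputable def multiplicityAt (k L : Type) [Field k] [Field L] [Algebra k L] {n : ℕ}
    (I : Ideal (MvPolynomial (Fin n) k)) (p : Fin n → L)
    (hp : ∀ f ∈ I, MvPolynomial.aeval p f = 0) : ℕ :=
  -- `J = I·L[X]`
  let J : Ideal (MvPolynomial (Fin n) L) := Ideal.map (MvPolynomial.map (algebraMap k L)) I
  -- evaluation at `p` on `L[X]/J`; its kernel is the maximal ideal corresponding to `p`
  let φ : (MvPolynomial (Fin n) L ⧸ J) →+* L :=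
    Ideal.Quotient.lift J (MvPolynomial.aeval p).toRingHom (by
      intro a ha
      have h : J ≤ RingHom.ker
          ((MvPolynomial.aeval p : MvPolynomial (Fin n) L →ₐ[L] L) : MvPolynomial (Fin n) L →+* L) := by
        rw [Ideal.map_le_iff_le_comap]
        intro f hf
        simp only [Ideal.mem_comap, RingHom.mem_ker, RingHom.coe_coe,
          MvPolynomial.aeval_map_algebraMap]
        exact hp f hf
      exact RingHom.mem_ker.mp (h ha))
  haveI : (RingHom.ker φ).IsPrime := RingHom.ker_isPrime φ
  letI : Algebra L (Localization.AtPrime (RingHom.ker φ)) :=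
    ((algebraMap (MvPolynomial (Fin n) L ⧸ J) (Localization.AtPrime (RingHom.ker φ))).comp
      (algebraMap L (MvPolynomial (Fin n) L ⧸ J))).toAlgebra
  Module.finrank L (Localization.AtPrime (RingHom.ker φ))

attribute [local instance] RingHom.ker_isPrime

theorem aux_map (k L : Type) [Field k] [Field L] [Algebra k L] (n : ℕ)
    (I : Ideal (MvPolynomial (Fin n) k)) :
    Ideal.map (MvPolynomial.map (algebraMap k L)) I =
    Ideal.map (MvPolynomial.algebraTensorAlgEquiv k L (σ := Fin n) : _ →+* MvPolynomial (Fin n) L)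
      (I.map (Algebra.TensorProduct.includeRight (A := L) (R := k)
        (B := MvPolynomial (Fin n) k))) := by
  apply le_antisymm
  · rw [Ideal.map_le_iff_le_comap]
    intro f hf
    have := Ideal.mem_map_of_mem (MvPolynomial.algebraTensorAlgEquiv k L (σ := Fin n) :
      _ →+* MvPolynomial (Fin n) L) (Ideal.mem_map_of_mem
        (Algebra.TensorProduct.includeRight (A := L) (R := k) (B := MvPolynomial (Fin n) k)) hf)
    simpa using this
  · rw [Ideal.map_le_iff_le_comap, Ideal.map_le_iff_le_comap]
    intro f hf
    have := Ideal.mem_map_of_mem (MvPolynomial.map (algebraMap k L)) hf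
    simpa using this

theorem aux_finsum {α M : Type} [AddCommMonoid M] (P : α → Prop) (f : ∀ a, P a → M) :
    ∑ᶠ (a : α) (h : P a), f a h = ∑ᶠ x : {a // P a}, f x.1 x.2 := by
  classical
  have := finsum_subtype_eq_finsum_cond (f := fun a => if h : P a then f a h else 0) P
  calc _ = ∑ᶠ (a : α) (h : P a), (if h : P a then f a h else 0) := by
        refine finsum_congr fun a => finsum_congr fun h => ?_
        simp [h]
    _ = _ := by
        rw [← this]
        refine finsum_congr fun x => ?_
        simp [x.2]

open TensorProduct in
theorem aux_baseChange (k L : Type) [Field k] [Field L] [Algebra k L] (n : ℕ)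
    (I : Ideal (MvPolynomial (Fin n) k)) :
    ∃ e : (L ⊗[k] (MvPolynomial (Fin n) k ⧸ I)) ≃ₐ[L]
      (MvPolynomial (Fin n) L ⧸ Ideal.map (MvPolynomial.map (algebraMap k L)) I),
      ∀ h : MvPolynomial (Fin n) k, e (1 ⊗ₜ Ideal.Quotient.mk I h) =
        Ideal.Quotient.mk _ (MvPolynomial.map (algebraMap k L) h) := by
  let e1 := Algebra.TensorProduct.tensorQuotientEquiv (R := k) L (MvPolynomial (Fin n) k) L I
  let e2 := Ideal.quotientEquivAlg
    (I.map (Algebra.TensorProduct.includeRight (A := L) (R := k) (B := MvPolynomial (Fin n) k)))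
    (Ideal.map (MvPolynomial.map (algebraMap k L)) I)
    (MvPolynomial.algebraTensorAlgEquiv k L (σ := Fin n)) (by
      exact aux_map k L n I)
  refine ⟨e1.trans e2, fun h => ?_⟩
  have : e1 (1 ⊗ₜ Ideal.Quotient.mk I h) = Ideal.Quotient.mk _ (1 ⊗ₜ h) := by
    simp [e1]
    try rfl
  rw [AlgEquiv.trans_apply, this]
  simp [e2]

theorem aux_pi (L : Type) [Field L] {ι : Type} [Fintype ι] [DecidableEq ι] (B : ι → Type)
    [∀ i, CommRing (B i)] [∀ i, Algebra L (B i)] [∀ i, FiniteDimensional L (B i)]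
    (x : ∀ i, B i) : Algebra.trace L (∀ i, B i) x = ∑ i, Algebra.trace L (B i) (x i) := by
  conv_lhs => rw [← Finset.univ_sum_single x, map_sum]
  refine Finset.sum_congr rfl fun i _ => ?_
  have : Algebra.lmul L (∀ i, B i) (Pi.single i (x i)) =
      LinearMap.single L B i ∘ₗ (Algebra.lmul L (B i) (x i) ∘ₗ LinearMap.proj i) := by
    ext j y m
    by_cases h : m = i
    · subst h; simp
    · simp [h]
  rw [Algebra.trace_apply, this, LinearMap.trace_comp_comm', Algebra.trace_apply]
  congr 1
  ext y
  simp

theorem aux_local (L A : Type) [Field L] [CommRing A] [Algebra L A] [FiniteDimensional L A]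
    (P : Ideal A) [P.IsPrime] (φ : A →ₐ[L] L) (hP : RingHom.ker φ = P) (a : A) :
    Algebra.trace L (Localization.AtPrime P) (algebraMap A _ a) =
      (Module.finrank L (Localization.AtPrime P) : L) * φ a := by
  haveI : IsArtinianRing A := IsArtinianRing.of_finite L A
  have hn : IsNilpotent (algebraMap A (Localization.AtPrime P) (a - algebraMap L A (φ a))) := by
    rw [Ring.KrullDimLE.isNilpotent_iff_mem_maximalIdeal]
    rw [← Ideal.mem_comap, ← Ideal.under_def, IsLocalization.AtPrime.under_maximalIdeal _ P, ← hP]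
    simp [RingHom.mem_ker]
  have h2 := (Algebra.isNilpotent_trace_of_isNilpotent (R := L) hn).eq_zero
  rw [map_sub, map_sub, sub_eq_zero, ← IsScalarTower.algebraMap_apply,
    Algebra.trace_algebraMap] at h2
  rw [h2, nsmul_eq_mul]

theorem aux_main (L A : Type) [Field L] [IsAlgClosed L] [CommRing A] [Algebra L A]
    [FiniteDimensional L A] (a : A) :
    Algebra.trace L A a = ∑ᶠ φ : A →ₐ[L] L,
      (Module.finrank L (Localization.AtPrime (RingHom.ker (φ : A →+* L))) : L) * φ a := by
  classical
  haveI : IsArtinianRing A := IsArtinianRing.of_finite L A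
  haveI : Fintype (PrimeSpectrum A) := Fintype.ofFinite _
  haveI (P : PrimeSpectrum A) : FiniteDimensional L (Localization.AtPrime P.asIdeal) :=
    Module.Finite.of_surjective (IsScalarTower.toAlgHom L A (Localization.AtPrime P.asIdeal)).toLinearMap
      (IsArtinianRing.localization_surjective P.asIdeal.primeCompl _)
  let e : A ≃ₐ[L] ∀ P : PrimeSpectrum A, Localization.AtPrime P.asIdeal :=
    AlgEquiv.ofBijective ((PrimeSpectrum.toPiLocalization A).restrictScalars L)
      PrimeSpectrum.toPiLocalization_bijective
  rw [← Algebra.trace_eq_of_algEquiv e, aux_pi]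
  have hex (P : PrimeSpectrum A) : ∃ φ : A →ₐ[L] L, RingHom.ker φ = P.asIdeal := by
    have hb := IsAlgClosed.algebraMap_bijective_of_isIntegral (k := L) (K := A ⧸ P.asIdeal)
    let g := AlgEquiv.ofBijective (Algebra.ofId L (A ⧸ P.asIdeal)) hb
    refine ⟨(g.symm : (A ⧸ P.asIdeal) →ₐ[L] L).comp (Ideal.Quotient.mkₐ L P.asIdeal), ?_⟩
    ext x
    simp [RingHom.mem_ker, Ideal.Quotient.eq_zero_iff_mem]
  choose Φ hΦ using hex
  have hbij : Function.Bijective Φ := by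
    constructor
    · intro P Q h
      ext1
      rw [← hΦ, ← hΦ, h]
    · intro φ
      refine ⟨⟨RingHom.ker φ, RingHom.ker_isPrime _⟩, ?_⟩
      ext x
      have : x - algebraMap L A (φ x) ∈ RingHom.ker φ := by simp [RingHom.mem_ker]
      have h2 := hΦ ⟨RingHom.ker φ, RingHom.ker_isPrime _⟩
      simp only at h2
      rw [← h2, RingHom.mem_ker] at this
      simpa [sub_eq_zero] using this
  rw [← finsum_eq_of_bijective Φ hbij (fun _ => rfl), finsum_eq_sum_of_fintype]
  refine Finset.sum_congr rfl fun P _ => ?_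
  have h1 := aux_local L A P.asIdeal (Φ P) (hΦ P) a
  have h2 : ∀ (Q : Ideal A) [Q.IsPrime], Q = P.asIdeal →
     Module.finrank L (Localization.AtPrime Q) =
     Module.finrank L (Localization.AtPrime P.asIdeal) := by
    rintro Q _ rfl; rfl
  rw [h2 (RingHom.ker (Φ P : A →+* L)) (hΦ P)]
  exact h1

theorem aux_mult (k L : Type) [Field k] [Field L] [Algebra k L] {n : ℕ}
    (I : Ideal (MvPolynomial (Fin n) k)) (p : Fin n → L)
    (hp : ∀ f ∈ I, MvPolynomial.aeval p f = 0)
    (φ : (MvPolynomial (Fin n) L ⧸ Ideal.map (MvPolynomial.map (algebraMap k L)) I) →ₐ[L] L)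
    (hφ : ∀ i, φ (Ideal.Quotient.mk _ (MvPolynomial.X i)) = p i) :
    multiplicityAt k L I p hp = Module.finrank L (Localization.AtPrime
      (RingHom.ker (φ : (MvPolynomial (Fin n) L ⧸
        Ideal.map (MvPolynomial.map (algebraMap k L)) I) →+* L))) := by
  have key : ∀ (ψ : (MvPolynomial (Fin n) L ⧸
        Ideal.map (MvPolynomial.map (algebraMap k L)) I) →+* L), ψ = φ →
      Module.finrank L (Localization.AtPrime (RingHom.ker ψ)) =
      Module.finrank L (Localization.AtPrime
      (RingHom.ker (φ : (MvPolynomial (Fin n) L ⧸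
        Ideal.map (MvPolynomial.map (algebraMap k L)) I) →+* L))) := by
    rintro ψ rfl
    rfl
  unfold multiplicityAt
  refine key _ ?_
  apply Ideal.Quotient.ringHom_ext
  apply MvPolynomial.ringHom_ext
  · intro r
    have := φ.commutes r
    simp
    exact this.symm
  · intro i
    simp [hφ]

/-- for every `h ∈ k[X]`, the trace of the multiplication map `m_h` on
`k[X]/I`, viewed in `L`, equals `∑_{p ∈ V_L(I)} μ(p)·h(p)`. -/
theorem stmt_3 (k L : Type) [Field k] [CharZero k] [Field L] [Algebra k L]
    [IsAlgClosure k L] (n : ℕ) (I : Ideal (MvPolynomial (Fin n) k))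
    [FiniteDimensional k (MvPolynomial (Fin n) k ⧸ I)]
    (h : MvPolynomial (Fin n) k) :
    algebraMap k L (LinearMap.trace k (MvPolynomial (Fin n) k ⧸ I)
        (LinearMap.mulLeft k ((Ideal.Quotient.mk I) h)))
      = ∑ᶠ (p : Fin n → L) (hp : ∀ f ∈ I, MvPolynomial.aeval p f = 0),
          (multiplicityAt k L I p hp : L) * MvPolynomial.aeval p h := by
  haveI : IsAlgClosed L := IsAlgClosure.isAlgClosed k
  obtain ⟨e, he⟩ := aux_baseChange k L n I
  haveI : FiniteDimensional L
      (MvPolynomial (Fin n) L ⧸ Ideal.map (MvPolynomial.map (algebraMap k L)) I) :=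
    Module.Finite.equiv e.toLinearEquiv
  have h1 : algebraMap k L (LinearMap.trace k (MvPolynomial (Fin n) k ⧸ I)
        (LinearMap.mulLeft k ((Ideal.Quotient.mk I) h))) = Algebra.trace L
      (MvPolynomial (Fin n) L ⧸ Ideal.map (MvPolynomial.map (algebraMap k L)) I)
      (Ideal.Quotient.mk _ (MvPolynomial.map (algebraMap k L) h)) := by
    rw [← he]
    refine Eq.trans ?_ (Algebra.trace_eq_of_algEquiv (A := L) (B := TensorProduct k L
      (MvPolynomial (Fin n) k ⧸ I)) e (TensorProduct.tmul k 1 (Ideal.Quotient.mk I h))).symm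
    rw [← LinearMap.trace_baseChange, Algebra.trace_apply]
    congr 1
    ext x
    simp
  have hX : ∀ (φ : (MvPolynomial (Fin n) L ⧸
      Ideal.map (MvPolynomial.map (algebraMap k L)) I) →ₐ[L] L) (f : MvPolynomial (Fin n) k),
      φ (Ideal.Quotient.mk _ (MvPolynomial.map (algebraMap k L) f)) =
        MvPolynomial.aeval (fun i => φ (Ideal.Quotient.mk _ (MvPolynomial.X i))) f := by
    intro φ f
    have : (φ.comp (Ideal.Quotient.mkₐ L _)) = MvPolynomial.aeval
        (fun i => φ (Ideal.Quotient.mk _ (MvPolynomial.X i))) := by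
      ext i
      simp
    have h3 := DFunLike.congr_fun this (MvPolynomial.map (algebraMap k L) f)
    rw [MvPolynomial.aeval_map_algebraMap] at h3
    exact h3
  have hz : ∀ (φ : (MvPolynomial (Fin n) L ⧸
      Ideal.map (MvPolynomial.map (algebraMap k L)) I) →ₐ[L] L), ∀ f ∈ I,
        MvPolynomial.aeval (fun i => φ (Ideal.Quotient.mk _ (MvPolynomial.X i))) f = 0 := by
    intro φ f hf
    rw [← hX, Ideal.Quotient.eq_zero_iff_mem.mpr (Ideal.mem_map_of_mem _ hf), map_zero]
  let S : ((MvPolynomial (Fin n) L ⧸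
      Ideal.map (MvPolynomial.map (algebraMap k L)) I) →ₐ[L] L) →
      {p : Fin n → L // ∀ f ∈ I, MvPolynomial.aeval p f = 0} :=
    fun φ => ⟨fun i => φ (Ideal.Quotient.mk _ (MvPolynomial.X i)), hz φ⟩
  have hS : Function.Bijective S := by
    constructor
    · intro φ ψ hh
      have hh' := congrArg Subtype.val hh
      apply Ideal.Quotient.algHom_ext
      ext i
      exact congrFun hh' i
    · rintro ⟨p, hp⟩
      refine ⟨Ideal.Quotient.liftₐ _ (MvPolynomial.aeval p) ?_, ?_⟩
      · intro a ha
        have hle : Ideal.map (MvPolynomial.map (algebraMap k L)) I ≤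
            RingHom.ker (MvPolynomial.aeval p : MvPolynomial (Fin n) L →ₐ[L] L) := by
          rw [Ideal.map_le_iff_le_comap]
          intro f hf
          simpa [RingHom.mem_ker, MvPolynomial.aeval_map_algebraMap] using hp f hf
        exact hle ha
      · apply Subtype.ext
        funext i
        exact MvPolynomial.aeval_X p i
  rw [h1, aux_main, aux_finsum]
  exact finsum_eq_of_bijective S hS fun φ => by
    rw [aux_mult k L I _ (S φ).2 φ (fun i => rfl), hX]
end

section
/- Let k be a field of characteristic 0 with algebraic closure L, let I ⊆ k[x_1,…,x_n] be a zero-dimensional ideal, and let t ∈ k[x_1,…,x_n] separate V_L(I). For v ∈ k[x_1,…,x_n], define g(v,T) = ∑_{α ∈ V_L(I)} μ(α)·v(α)·∏_{y ∈ t(V_L(I)), y ≠ t(α)} (T − y) ∈ L[T], and let χ̄_t ∈ L[T] be the squarefree part of the characteristic polynomial of m_t. Then for every root β of χ̄_t in L one has g(1,β) ≠ 0, and V_L(I) = { ( g(x_1,β)/g(1,β), …, g(x_n,β)/g(1,β) ) : β ∈ V_L(χ̄_t) }. -/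
set_option synthInstance.maxHeartbeats 1000000
set_option maxHeartbeats 1000000

open scoped TensorProduct

theorem aux_finrank (L B : Type) [Field L] [CommRing B] [Algebra L B] [Module.Finite L B]
    (P : Ideal B) [P.IsPrime] :
    Module.finrank L (Localization.AtPrime P) ≠ 0 := by
  have : IsArtinianRing B := IsArtinianRing.of_finite L B
  have hs : Function.Surjective (algebraMap B (Localization.AtPrime P)) :=
    IsArtinianRing.localization_surjective P.primeCompl _
  have : Module.Finite L (Localization.AtPrime P) :=
    Module.Finite.of_surjective (IsScalarTower.toAlgHom L B (Localization.AtPrime P)).toLinearMap hs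
  exact (Module.finrank_pos).ne'

theorem aux_finite (k L : Type) [Field k] [Field L] [Algebra k L] (n : ℕ)
    (I : Ideal (MvPolynomial (Fin n) k)) [FiniteDimensional k (MvPolynomial (Fin n) k ⧸ I)] :
    Module.Finite L (MvPolynomial (Fin n) L ⧸ Ideal.map (MvPolynomial.map (algebraMap k L)) I) := by
  set J := Ideal.map (MvPolynomial.map (algebraMap k L)) I with hJ
  let f0 : (MvPolynomial (Fin n) k) →ₐ[k] (MvPolynomial (Fin n) L ⧸ J) :=
    MvPolynomial.aeval (fun i => Ideal.Quotient.mk J (MvPolynomial.X i))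
  have hf0 : ∀ p, f0 p = Ideal.Quotient.mk J (MvPolynomial.map (algebraMap k L) p) := by
    intro p
    induction p using MvPolynomial.induction_on with
    | C a =>
      simp only [f0, MvPolynomial.aeval_C, MvPolynomial.map_C]
      rfl
    | add p q hp hq => simp [hp, hq]
    | mul_X p i hp => 
      rw [map_mul, hp]
      simp [f0]
  let f1 : (MvPolynomial (Fin n) k ⧸ I) →ₐ[k] (MvPolynomial (Fin n) L ⧸ J) :=
    Ideal.Quotient.liftₐ I f0 (by
      intro a ha
      rw [hf0]
      exact Ideal.Quotient.eq_zero_iff_mem.mpr (Ideal.mem_map_of_mem _ ha))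
  let F : TensorProduct k L (MvPolynomial (Fin n) k ⧸ I) →ₐ[L] (MvPolynomial (Fin n) L ⧸ J) :=
    Algebra.TensorProduct.lift (Algebra.ofId L _) f1 (fun _ _ => Commute.all _ _)
  refine Module.Finite.of_surjective F.toLinearMap ?_
  intro y
  obtain ⟨p, rfl⟩ := Ideal.Quotient.mk_surjective y
  show ∃ a, F a = _
  induction p using MvPolynomial.induction_on with
  | C a => exact ⟨algebraMap L _ a, by rw [AlgHom.commutes]; rfl⟩
  | add p q hp hq =>
    obtain ⟨a, ha⟩ := hp
    obtain ⟨b, hb⟩ := hq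
    exact ⟨a + b, by rw [map_add, ha, hb, map_add]⟩
  | mul_X p i hp =>
    obtain ⟨a, ha⟩ := hp
    refine ⟨a * (1 ⊗ₜ Ideal.Quotient.mk I (MvPolynomial.X i)), ?_⟩
    rw [map_mul, ha, map_mul]
    congr 1
    simp only [F, Algebra.TensorProduct.lift_tmul, map_one, one_mul]
    show f0 (MvPolynomial.X i) = _
    simp [f0]

theorem aux_mult_s6 (k L : Type) [Field k] [Field L] [Algebra k L] {n : ℕ}
    (I : Ideal (MvPolynomial (Fin n) k)) [FiniteDimensional k (MvPolynomial (Fin n) k ⧸ I)]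
    (p : Fin n → L) (hp : ∀ f ∈ I, MvPolynomial.aeval p f = 0) :
    multiplicityAt k L I p hp ≠ 0 := by
  have := aux_finite k L n I
  unfold multiplicityAt
  extract_lets J φ
  have : (RingHom.ker φ).IsPrime := RingHom.ker_isPrime φ
  exact aux_finrank L _ (RingHom.ker φ)

theorem aux_hom (k L A : Type) [Field k] [Field L] [Algebra k L] [IsAlgClosed L]
    [CommRing A] [Algebra k A] [FiniteDimensional k A] (τ : A) (β : L)
    (h : ((LinearMap.charpoly (LinearMap.mulLeft k τ)).map (algebraMap k L)).IsRoot β) :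
    ∃ ψ : A →ₐ[k] L, ψ τ = β := by
  rw [← LinearMap.charpoly_baseChange, ← Module.End.hasEigenvalue_iff_isRoot_charpoly] at h
  obtain ⟨v, hv⟩ := h.exists_hasEigenvector
  have hv0 := hv.2
  have hv1 := hv.apply_eq_smul
  have hmul : ∀ w : L ⊗[k] A, (LinearMap.mulLeft k τ).baseChange L w = ((1 : L) ⊗ₜ[k] τ) * w := by
    intro w
    induction w using TensorProduct.induction_on with
    | zero => simp
    | tmul a b => simp
    | add a b ha hb => rw [map_add, ha, hb, mul_add]
  obtain ⟨s, hs⟩ : ∃ s : L ⊗[k] A, s = ((1 : L) ⊗ₜ[k] τ) - algebraMap L (L ⊗[k] A) β := ⟨_, rfl⟩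
  have hsv : s * v = 0 := by
    rw [hs, sub_mul, ← hmul, hv1, Algebra.smul_def, sub_self]
  have hnu : ¬ IsUnit s := by
    intro hu
    exact hv0 ((hu.mul_right_eq_zero).mp hsv)
  obtain ⟨M, hM, hsM⟩ := exists_max_ideal_of_mem_nonunits hnu
  let _ := Ideal.Quotient.field M
  have hbij := IsAlgClosed.algebraMap_bijective_of_isIntegral (k := L) (K := (L ⊗[k] A) ⧸ M)
  let e := AlgEquiv.ofBijective (Algebra.ofId L ((L ⊗[k] A) ⧸ M)) hbij
  let ψ : (L ⊗[k] A) →ₐ[L] L := e.symm.toAlgHom.comp (Ideal.Quotient.mkₐ L M)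
  have hψ : ψ s = 0 := by
    have : Ideal.Quotient.mkₐ L M s = 0 := Ideal.Quotient.eq_zero_iff_mem.mpr hsM
    show e.symm (Ideal.Quotient.mkₐ L M s) = 0
    rw [this, map_zero]
  refine ⟨(ψ.restrictScalars k).comp Algebra.TensorProduct.includeRight, ?_⟩
  rw [hs, map_sub, AlgHom.commutes, sub_eq_zero] at hψ
  exact hψ

theorem aux_root (k L : Type) [Field k] [Field L] [Algebra k L] [IsAlgClosed L] (n : ℕ)
    (I : Ideal (MvPolynomial (Fin n) k)) [FiniteDimensional k (MvPolynomial (Fin n) k ⧸ I)]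
    (t : MvPolynomial (Fin n) k) (β : L) :
    ((LinearMap.charpoly (LinearMap.mulLeft k ((Ideal.Quotient.mk I) t))).map
      (algebraMap k L)).IsRoot β ↔
    ∃ p : Fin n → L, (∀ f ∈ I, MvPolynomial.aeval p f = 0) ∧ MvPolynomial.aeval p t = β := by
  constructor
  · intro h
    obtain ⟨ψ, hψ⟩ := aux_hom k L _ _ β h
    let θ : MvPolynomial (Fin n) k →ₐ[k] L :=
      ψ.comp (Ideal.Quotient.mkₐ k I)
    have hθ : ∀ f, MvPolynomial.aeval (fun i => θ (MvPolynomial.X i)) f = θ f := by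
      intro f
      exact (DFunLike.congr_fun (MvPolynomial.aeval_unique θ) f).symm
    refine ⟨fun i => θ (MvPolynomial.X i), ?_, ?_⟩
    · intro f hf
      rw [hθ]
      have : Ideal.Quotient.mkₐ k I f = 0 := Ideal.Quotient.eq_zero_iff_mem.mpr hf
      simp only [θ, AlgHom.comp_apply, this, map_zero]
    · rw [hθ]
      exact hψ
  · rintro ⟨p, hp, rfl⟩
    let θ : (MvPolynomial (Fin n) k ⧸ I) →ₐ[k] L := Ideal.Quotient.liftₐ I (MvPolynomial.aeval p) hp
    have h1 := LinearMap.aeval_self_charpoly (LinearMap.mulLeft k ((Ideal.Quotient.mk I) t))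
    have h2 : Polynomial.aeval (Ideal.Quotient.mk I t) (LinearMap.charpoly
        (LinearMap.mulLeft k ((Ideal.Quotient.mk I) t))) = 0 := by
      have h3 : LinearMap.mulLeft k ((Ideal.Quotient.mk I) t) =
        Algebra.lmul k _ ((Ideal.Quotient.mk I) t) := rfl
      have h4 := congrArg (fun f => f 1) h1
      generalize (LinearMap.mulLeft k ((Ideal.Quotient.mk I) t)).charpoly = q at h4 ⊢
      rw [h3, Polynomial.aeval_algHom_apply] at h4
      simpa using h4
    have h5 := congrArg θ h2
    rw [← Polynomial.aeval_algHom_apply, map_zero] at h5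
    rw [Polynomial.IsRoot.def, Polynomial.eval_map_algebraMap]
    exact h5

/-- correctness of the Rational Univariate Representation.  If `t` separates
`V_L(I)` and `g(v,T) = ∑_{α ∈ V_L(I)} μ(α)·v(α)·∏_{y ∈ t(V_L(I)), y ≠ t(α)} (T − y)`, and
`χ̄_t` is the squarefree part of the characteristic polynomial of `m_t`, then `g(1,β) ≠ 0`
for every root `β` of `χ̄_t`, and
`V_L(I) = { (g(x_1,β)/g(1,β), …, g(x_n,β)/g(1,β)) : β ∈ V_L(χ̄_t) }`. -/
theorem stmt_6 (k L : Type) [Field k] [CharZero k] [Field L] [Algebra k L]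
    [IsAlgClosure k L] [DecidableEq (Polynomial L)]
    (n : ℕ) (I : Ideal (MvPolynomial (Fin n) k))
    [FiniteDimensional k (MvPolynomial (Fin n) k ⧸ I)]
    (t : MvPolynomial (Fin n) k)
    (ht : Set.InjOn (fun p : Fin n → L => MvPolynomial.aeval p t)
      {p : Fin n → L | ∀ f ∈ I, MvPolynomial.aeval p f = 0})
    (g : MvPolynomial (Fin n) k → Polynomial L)
    (hg : ∀ v : MvPolynomial (Fin n) k,
      g v = ∑ᶠ (α : Fin n → L) (hα : ∀ f ∈ I, MvPolynomial.aeval α f = 0),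
        Polynomial.C (multiplicityAt k L I α hα : L) * Polynomial.C (MvPolynomial.aeval α v) *
          ∏ᶠ (y : L) (_ : y ∈ ((fun p : Fin n → L => MvPolynomial.aeval p t) ''
              {p : Fin n → L | ∀ f ∈ I, MvPolynomial.aeval p f = 0}) \ {MvPolynomial.aeval α t}),
            (Polynomial.X - Polynomial.C y))
    (χL sf : Polynomial L)
    (hχL : χL = (LinearMap.charpoly
        (LinearMap.mulLeft k ((Ideal.Quotient.mk I) t))).map (algebraMap k L))
    (hsf : sf = χL / EuclideanDomain.gcd χL (Polynomial.derivative χL)) :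
    (∀ β : L, sf.IsRoot β → (g 1).eval β ≠ 0) ∧
      {p : Fin n → L | ∀ f ∈ I, MvPolynomial.aeval p f = 0}
        = (fun β : L => fun i : Fin n => (g (MvPolynomial.X i)).eval β / (g 1).eval β) ''
            {β : L | sf.IsRoot β} := by
  classical
  have : IsAlgClosed L := IsAlgClosure.isAlgClosed k
  have : CharZero L := charZero_of_injective_algebraMap (algebraMap k L).injective
  have hχ0 : χL ≠ 0 := by
    rw [hχL]
    exact ((LinearMap.charpoly_monic _).map _).ne_zero
  have hroot : ∀ β, χL.IsRoot β ↔ ∃ p : Fin n → L,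
      (∀ f ∈ I, MvPolynomial.aeval p f = 0) ∧ MvPolynomial.aeval p t = β := by
    intro β
    rw [hχL]
    exact aux_root k L n I t β
  have hd : EuclideanDomain.gcd χL (Polynomial.derivative χL) * sf = χL := by
    rw [hsf]
    exact EuclideanDomain.mul_div_cancel' (fun h => hχ0 (EuclideanDomain.gcd_eq_zero_iff.mp h).1)
      (EuclideanDomain.gcd_dvd_left _ _)
  have hsfroot : ∀ β, sf.IsRoot β ↔ χL.IsRoot β := by
    intro β
    constructor
    · intro h
      exact h.dvd ⟨_, by rw [mul_comm]; exact hd.symm⟩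
    · intro h
      refine Polynomial.isRoot_of_isRoot_of_dvd_derivative_mul hχ0 ?_ h
      conv_lhs => rw [← hd]
      exact mul_dvd_mul_right (EuclideanDomain.gcd_dvd_right _ _) _
  set V : Set (Fin n → L) := {p : Fin n → L | ∀ f ∈ I, MvPolynomial.aeval p f = 0} with hV
  have htV : ((fun p : Fin n → L => MvPolynomial.aeval p t) '' V).Finite := by
    refine (χL.rootSet_finite L).subset ?_
    rintro _ ⟨p, hp, rfl⟩
    rw [Polynomial.mem_rootSet]
    refine ⟨hχ0, ?_⟩
    have := (hroot _).mpr ⟨p, hp, rfl⟩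
    simpa using this
  have hVf : V.Finite := Set.Finite.of_finite_image htV ht
  have key : ∀ α ∈ V, ∃ c : L, c ≠ 0 ∧ ∀ v, (g v).eval (MvPolynomial.aeval α t) =
      c * MvPolynomial.aeval α v := by
    intro α hα
    let Q : (Fin n → L) → Polynomial L := fun α =>
      ∏ᶠ (y : L) (_ : y ∈ ((fun p : Fin n → L => MvPolynomial.aeval p t) '' V) \
        {MvPolynomial.aeval α t}), (Polynomial.X - Polynomial.C y)
    have hQ : ∀ α β, (Q α).eval β =
        ∏ y ∈ (htV.subset (Set.sdiff_subset (t := {MvPolynomial.aeval α t}))).toFinset, (β - y) := by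
      intro α β
      simp only [Q]
      rw [finprod_mem_eq_finite_toFinset_prod _
        (htV.subset (Set.sdiff_subset (t := {MvPolynomial.aeval α t}))), Polynomial.eval_prod]
      simp
    refine ⟨(multiplicityAt k L I α hα : L) * (Q α).eval (MvPolynomial.aeval α t), ?_, ?_⟩
    · refine mul_ne_zero (Nat.cast_ne_zero.mpr (aux_mult_s6 k L I α hα)) ?_
      rw [hQ, Finset.prod_ne_zero_iff]
      intro y hy
      rw [Set.Finite.mem_toFinset] at hy
      exact sub_ne_zero.mpr (fun h => hy.2 h.symm)
    · intro v
      have hG : ∀ γ, ∀ hγ : ∀ f ∈ I, MvPolynomial.aeval γ f = 0,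
          (∑ᶠ hα : ∀ f ∈ I, MvPolynomial.aeval γ f = 0,
            Polynomial.C (multiplicityAt k L I γ hα : L) *
              Polynomial.C (MvPolynomial.aeval γ v) * Q γ) =
          Polynomial.C (multiplicityAt k L I γ hγ : L) *
              Polynomial.C (MvPolynomial.aeval γ v) * Q γ := by
        intro γ hγ
        rw [finsum_eq_dif, dif_pos hγ]
      rw [hg v]
      rw [finsum_eq_sum_of_support_subset (s := hVf.toFinset)]
      · rw [Polynomial.eval_finsetSum, Finset.sum_eq_single α]
        · rw [hG α hα]
          simp only [Polynomial.eval_mul, Polynomial.eval_C]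
          ring
        · intro γ hγ hne
          rw [Set.Finite.mem_toFinset] at hγ
          rw [hG γ hγ]
          simp only [Polynomial.eval_mul, Polynomial.eval_C]
          have : (Q γ).eval (MvPolynomial.aeval α t) = 0 := by
            rw [hQ]
            refine Finset.prod_eq_zero (i := MvPolynomial.aeval α t) ?_ (sub_self _)
            rw [Set.Finite.mem_toFinset]
            exact ⟨⟨α, hα, rfl⟩, fun h => hne (ht hγ hα h.symm)⟩
          exact mul_eq_zero_of_right _ this
        · intro h
          exact absurd (hVf.mem_toFinset.mpr hα) h
      · intro γ hγ
        by_contra hc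
        apply hγ
        beta_reduce
        rw [finsum_eq_dif, dif_neg (fun h : ∀ f ∈ I, MvPolynomial.aeval γ f = 0 =>
          hc (Finset.mem_coe.mpr (hVf.mem_toFinset.mpr h)))]
  have key2 : ∀ α ∈ V, (g 1).eval (MvPolynomial.aeval α t) ≠ 0 ∧
      (fun i : Fin n => (g (MvPolynomial.X i)).eval (MvPolynomial.aeval α t) /
        (g 1).eval (MvPolynomial.aeval α t)) = α := by
    intro α hα
    obtain ⟨c, hc, h⟩ := key α hα
    refine ⟨by rw [h]; simpa using hc, ?_⟩
    funext i
    rw [h, h]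
    simp [hc]
  refine ⟨?_, ?_⟩
  · intro β hβ
    obtain ⟨p, hp, rfl⟩ := (hroot β).mp ((hsfroot β).mp hβ)
    exact (key2 p hp).1
  · ext p
    constructor
    · intro hp
      exact ⟨MvPolynomial.aeval p t, (hsfroot _).mpr ((hroot _).mpr ⟨p, hp, rfl⟩), (key2 p hp).2⟩
    · rintro ⟨β, hβ, rfl⟩
      obtain ⟨p, hp, rfl⟩ := (hroot β).mp ((hsfroot β).mp hβ)
      have := (key2 p hp).2
      simp only [this]
      exact hp
end
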